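/- (Fujii's Lemma, vector-valued) Let E be a Banach space, let λ ∈ (0, 1/2), and let f : ℝ^d → E be a strongly measurable function. Then for almost every x ∈ ℝ^d the following holds: for every ε > 0 there exists δ > 0 such that for every axis-parallel cube Q with x ∈ Q and |Q| < δ, and for every quasi-optimal center of oscillation c of f on Q with a λ-portion disregarded, one has ‖f(x) − c‖ < 4ε. -/

import Mathlib

open MeasureTheory Set

/-- The least bound `ρ_λ(f;Q)`: the infimum of all `r ≥ 0` such that
`|{x ∈ Q : ‖f(x)‖ > r}| ≤ λ|Q|`. -/
noncomputable def leastBound {E : Type*} [NormedAddCommGroup E] {d : ℕ} (lam : ℝ)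
    (f : (Fin d → ℝ) → E) (Q : Set (Fin d → ℝ)) : ℝ :=
  sInf {r : ℝ | 0 ≤ r ∧ volume {x ∈ Q | r < ‖f x‖} ≤ ENNReal.ofReal lam * volume Q}

/-- The local oscillation `ω_λ(f;Q) := inf_{c ∈ E} ρ_λ(f - c; Q)`. -/
noncomputable def localOsc {E : Type*} [NormedAddCommGroup E] {d : ℕ} (lam : ℝ)
    (f : (Fin d → ℝ) → E) (Q : Set (Fin d → ℝ)) : ℝ :=
  ⨅ c : E, leastBound lam (fun x => f x - c) Q

/-- A quasi-optimal center of oscillation of `f` on `Q` with a `λ`-portion disregarded: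
any `m ∈ E` with `ρ_λ(f - m; Q) ≤ 2 ω_λ(f;Q)`. -/
def IsQuasiCenter {E : Type*} [NormedAddCommGroup E] {d : ℕ} (lam : ℝ)
    (f : (Fin d → ℝ) → E) (Q : Set (Fin d → ℝ)) (m : E) : Prop :=
  leastBound lam (fun x => f x - m) Q ≤ 2 * localOsc lam f Q

/-- The axis-parallel (half-open) cube with lower corner `a` and side length `l`. -/
def cube {d : ℕ} (a : Fin d → ℝ) (l : ℝ) : Set (Fin d → ℝ) :=
  univ.pi fun i => Ico (a i) (a i + l)

section Cube

variable {d : ℕ}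

theorem cube_subset_closedBall (a : Fin d → ℝ) {l : ℝ} (hl : 0 < l) :
    cube a l ⊆ Metric.closedBall (fun i => a i + l / 2) (l / 2) := by
  intro y hy
  rw [Metric.mem_closedBall, dist_pi_le_iff (by positivity)]
  intro i
  have h := hy i (mem_univ i)
  rw [Real.dist_eq, abs_le]
  constructor <;> linarith [h.1, h.2]

theorem volume_cube (a : Fin d → ℝ) {l : ℝ} (hl : 0 < l) :
    volume (cube a l) = ENNReal.ofReal (l ^ d) := by
  rw [cube, Real.volume_pi_Ico]
  simp [ENNReal.ofReal_pow hl.le]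

theorem volume_cube_eq_volume_closedBall (a : Fin d → ℝ) {l : ℝ} (hl : 0 < l) :
    volume (cube a l) = volume (Metric.closedBall (fun i => a i + l / 2) (l / 2)) := by
  rw [volume_cube a hl, Real.volume_pi_closedBall _ (by positivity)]
  simp [mul_div_cancel₀]

/-- Lebesgue's density theorem for small cubes containing, but not necessarily centered at, the
given point. -/
theorem ae_volume_cube_diff_le {lam : ℝ} (hlam : 0 < lam) {S : Set (Fin d → ℝ)}
    (hS : NullMeasurableSet S volume) :
    ∀ᵐ x : Fin d → ℝ, x ∈ S → ∃ η > (0 : ℝ), ∀ (a : Fin d → ℝ) (l : ℝ), 0 < l → l < η →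
      x ∈ cube a l → volume (cube a l \ S) ≤ ENNReal.ofReal lam * volume (cube a l) := by
  rw [← ae_restrict_iff'₀ hS]
  filter_upwards [IsUnifLocDoublingMeasure.ae_tendsto_measure_inter_div volume S 1] with x hx
  let F : Filter ((Fin d → ℝ) × ℝ) := Filter.comap Prod.snd (nhdsWithin 0 (Ioi 0)) ⊓
    Filter.principal {p | x ∈ Metric.closedBall p.1 p.2}
  have hlim := hx (l := F) Prod.fst Prod.snd (Filter.tendsto_comap.mono_left inf_le_left)
    (by simp only [one_mul]; exact Filter.mem_inf_of_right (Filter.mem_principal_self _))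
  have hev := hlim.eventually_const_le
    (show 1 - ENNReal.ofReal lam < 1 from ENNReal.sub_lt_self (by simp) (by simp) (by simpa))
  rw [Filter.eventually_inf_principal, Filter.eventually_comap] at hev
  obtain ⟨η, hη, hball⟩ := (nhdsGT_basis (0 : ℝ)).eventually_iff.1 hev
  refine ⟨η, hη, fun a l hl hlη hxa => ?_⟩
  have hsub := cube_subset_closedBall a hl
  set B := Metric.closedBall (fun i => a i + l / 2) (l / 2)
  have hBQ : volume (cube a l) = volume B := volume_cube_eq_volume_closedBall a hl
  have hratio : 1 - ENNReal.ofReal lam ≤ volume (S ∩ B) / volume B :=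
    hball (x := l / 2) ⟨by positivity, by linarith⟩ (fun i => a i + l / 2, l / 2) rfl (hsub hxa)
  have hfin : volume B ≠ ⊤ := measure_closedBall_lt_top.ne
  have hmul : volume B ≤ volume (B ∩ S) + ENNReal.ofReal lam * volume B := by
    have h := mul_le_mul_left (tsub_le_iff_right.1 hratio) (volume B)
    rw [one_mul, add_mul, ENNReal.div_mul_cancel (by rw [← hBQ, volume_cube a hl]; simp; positivity)
      hfin, inter_comm] at h
    exact h
  rw [hBQ]
  refine (measure_mono (sdiff_subset_sdiff_left hsub)).trans ?_
  exact (ENNReal.add_le_add_iff_left (measure_ne_top_of_subset inter_subset_left hfin)).1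
    ((measure_inter_add_sdiff₀ B hS).trans_le hmul)

end Cube

section Oscillation

variable {E : Type*} [NormedAddCommGroup E] {d : ℕ} {lam : ℝ} {f : (Fin d → ℝ) → E}
  {Q : Set (Fin d → ℝ)}

theorem leastBound_nonneg : 0 ≤ leastBound lam f Q :=
  Real.sInf_nonneg fun _ h => h.1

theorem leastBound_le {r : ℝ} (hr : 0 ≤ r)
    (h : volume {x ∈ Q | r < ‖f x‖} ≤ ENNReal.ofReal lam * volume Q) : leastBound lam f Q ≤ r :=
  csInf_le ⟨0, fun _ h => h.1⟩ ⟨hr, h⟩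

/-- A bound larger than the least bound is exceeded on at most a `λ`-portion of `Q`, as soon as
some bound is. -/
theorem volume_lt_norm_le_of_leastBound_lt {r s : ℝ} (hs : 0 ≤ s)
    (h : volume {x ∈ Q | s < ‖f x‖} ≤ ENNReal.ofReal lam * volume Q)
    (hr : leastBound lam f Q < r) :
    volume {x ∈ Q | r < ‖f x‖} ≤ ENNReal.ofReal lam * volume Q := by
  have hne : {r : ℝ | 0 ≤ r ∧ volume {x ∈ Q | r < ‖f x‖} ≤
      ENNReal.ofReal lam * volume Q}.Nonempty := ⟨s, hs, h⟩
  obtain ⟨t, ht, htr⟩ := exists_lt_of_csInf_lt hne hr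
  refine le_trans (measure_mono ?_) ht.2
  exact fun x hx => ⟨hx.1, htr.trans hx.2⟩

theorem localOsc_le (c : E) : localOsc lam f Q ≤ leastBound lam (fun x => f x - c) Q :=
  ciInf_le ⟨0, by rintro _ ⟨c, rfl⟩; exact leastBound_nonneg⟩ c

/-- If `f` is within `ε` of `v` on `Q` up to a `λ`-portion, then every quasi-optimal center of
oscillation of `f` on `Q` is within `4 ε` of `v`. -/
theorem IsQuasiCenter.norm_sub_lt {c v : E} {ε : ℝ} (hc : IsQuasiCenter lam f Q c)
    (hlam0 : 0 ≤ lam) (hlam : lam < 1 / 2) (hε : 0 < ε) (hQ0 : volume Q ≠ 0) (hQ : volume Q ≠ ⊤)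
    (hv : volume {x ∈ Q | ε < ‖f x - v‖} ≤ ENNReal.ofReal lam * volume Q) :
    ‖v - c‖ < 4 * ε := by
  have hlt : leastBound lam (fun x => f x - c) Q < 5 / 2 * ε := by
    have := hc.trans (mul_le_mul_of_nonneg_left
      ((localOsc_le v).trans (leastBound_le hε.le hv)) zero_le_two)
    linarith
  have hbd : volume {x ∈ Q | ε + ‖v - c‖ < ‖f x - c‖} ≤ ENNReal.ofReal lam * volume Q := by
    refine le_trans (measure_mono ?_) hv
    refine fun x hx => ⟨hx.1, ?_⟩
    have := norm_sub_le_norm_sub_add_norm_sub (f x) v c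
    linarith [hx.2]
  have hcen := volume_lt_norm_le_of_leastBound_lt (by positivity) hbd hlt
  obtain ⟨y, hyQ, hy⟩ : ∃ y ∈ Q, y ∉ {x ∈ Q | ε < ‖f x - v‖} ∪ {x ∈ Q | 5 / 2 * ε < ‖f x - c‖} := by
    by_contra! hall
    have h := ((measure_mono hall).trans (measure_union_le _ _)).trans (add_le_add hv hcen)
    rw [← add_mul, ← ENNReal.ofReal_add hlam0 hlam0] at h
    have hlt : ENNReal.ofReal (lam + lam) * volume Q < 1 * volume Q :=
      ENNReal.mul_lt_mul_left hQ0 hQ (by rw [ENNReal.ofReal_lt_one]; linarith)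
    rw [one_mul] at hlt
    exact h.not_gt hlt
  simp only [mem_union, mem_ofPred_eq, hyQ, true_and, not_or, not_lt] at hy
  have := norm_sub_le_norm_sub_add_norm_sub v (f y) c
  rw [norm_sub_rev v (f y)] at this
  linarith

end Oscillation

/-- Almost everywhere approximate continuity of a strongly measurable function, along small cubes
containing the given point. -/
theorem ae_volume_lt_norm_sub_le {E : Type*} [NormedAddCommGroup E] {d : ℕ} {lam : ℝ}
    (hlam : 0 < lam) {f : (Fin d → ℝ) → E} (hf : AEStronglyMeasurable f volume) :
    ∀ᵐ x : Fin d → ℝ, ∀ ε > (0 : ℝ), ∃ η > (0 : ℝ), ∀ (a : Fin d → ℝ) (l : ℝ), 0 < l → l < η →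
      x ∈ cube a l →
        volume {y ∈ cube a l | ε < ‖f y - f x‖} ≤ ENNReal.ofReal lam * volume (cube a l) := by
  obtain ⟨t, ⟨D, hD, htD⟩, ht⟩ := hf.isSeparable_ae_range
  have hdens : ∀ᵐ x : Fin d → ℝ, ∀ e ∈ D, ∀ n : ℕ, x ∈ {y | ‖f y - e‖ < 1 / ((n : ℝ) + 1)} →
      ∃ η > (0 : ℝ), ∀ (a : Fin d → ℝ) (l : ℝ), 0 < l → l < η → x ∈ cube a l →
        volume (cube a l \ {y | ‖f y - e‖ < 1 / ((n : ℝ) + 1)}) ≤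
          ENNReal.ofReal lam * volume (cube a l) := by
    refine (ae_ball_iff hD).2 fun e _ => ae_all_iff.2 fun n => ae_volume_cube_diff_le hlam ?_
    exact (hf.sub aestronglyMeasurable_const).norm.nullMeasurableSet_lt aestronglyMeasurable_const
  filter_upwards [ht, hdens] with x hxt hx ε hε
  obtain ⟨n, hn⟩ := exists_nat_one_div_lt (half_pos hε)
  obtain ⟨e, he, hxe⟩ := Metric.mem_closure_iff.1 (htD hxt) (1 / ((n : ℝ) + 1)) (by positivity)
  rw [dist_eq_norm] at hxe
  obtain ⟨η, hη, h⟩ := hx e he n hxe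
  refine ⟨η, hη, fun a l hl hlη hxa => (measure_mono ?_).trans (h a l hl hlη hxa)⟩
  rintro y ⟨hyQ, hy⟩
  refine ⟨hyQ, fun hye => ?_⟩
  rw [mem_ofPred_eq] at hye
  have := norm_sub_le_norm_sub_add_norm_sub (f y) e (f x)
  rw [norm_sub_rev e] at this
  linarith

/-- Fujii's Lemma, vector-valued: for a.e. `x`, quasi-optimal centers of
oscillation of `f` on small cubes containing `x` converge to `f(x)`. -/
theorem fujii_lemma {E : Type*} [NormedAddCommGroup E] [NormedSpace ℝ E]
    [CompleteSpace E] {d : ℕ} (hd : 1 ≤ d) (lam : ℝ) (hlam0 : 0 < lam) (hlam : lam < 1 / 2)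
    (f : (Fin d → ℝ) → E) (hf : AEStronglyMeasurable f volume) :
    ∀ᵐ x : Fin d → ℝ, ∀ ε > (0 : ℝ), ∃ δ > (0 : ℝ),
      ∀ (a : Fin d → ℝ) (l : ℝ), 0 < l → x ∈ cube a l →
        volume (cube a l) < ENNReal.ofReal δ →
        ∀ c : E, IsQuasiCenter lam f (cube a l) c → ‖f x - c‖ < 4 * ε := by
  filter_upwards [ae_volume_lt_norm_sub_le hlam0 hf] with x hx ε hε
  obtain ⟨η, hη, h⟩ := hx ε hε
  refine ⟨η ^ d, by positivity, fun a l hl hxa hvol c hc => ?_⟩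
  rw [volume_cube a hl, ENNReal.ofReal_lt_ofReal_iff (by positivity)] at hvol
  have hlη : l < η := lt_of_pow_lt_pow_left₀ d hη.le hvol
  exact hc.norm_sub_lt hlam0.le hlam hε (by rw [volume_cube a hl]; simp; positivity)
    (by rw [volume_cube a hl]; simp) (h a l hl hlη hxa)
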